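/- arXiv:2204.01037 — 4 statements merged into one kernel-verified Lean document; each statement's English description precedes it below -/
import Mathlib

section
/- (NS-Beltrami generalized steady flows are exact Navier–Stokes solutions.) Let ν, μ, h be real numbers and let u₀, u₁ : ℝ³ → ℝ³ be C² vector fields with div u₀ = div u₁ = 0 and curl u₀ = μ·u₀, curl u₁ = μ·u₁ everywhere. Define U(x,t) = u₀(x) + exp(−νμ²t)·u₁(x), the pressure p(x,t) = h − ‖U(x,t)‖²/2, and the force f(x) = ν μ²·u₀(x). Then U solves the incompressible Navier–Stokes equations: for all x, t and every component i, ∂ₜUᵢ + Σⱼ Uⱼ ∂ⱼUᵢ = −∂ᵢp + ν·(ΔU)ᵢ + fᵢ, and div U = 0. -/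
open Real

/-- Partial derivative of a scalar function on `ℝ³` in the `j`-th coordinate direction. -/
noncomputable def pd (j : Fin 3) (f : (Fin 3 → ℝ) → ℝ) (x : Fin 3 → ℝ) : ℝ :=
  fderiv ℝ f x (Pi.single j 1)

/-- The curl of a vector field on `ℝ³`. -/
noncomputable def curl (u : (Fin 3 → ℝ) → (Fin 3 → ℝ)) (x : Fin 3 → ℝ) : Fin 3 → ℝ :=
  ![pd 1 (fun y => u y 2) x - pd 2 (fun y => u y 1) x,
    pd 2 (fun y => u y 0) x - pd 0 (fun y => u y 2) x,
    pd 0 (fun y => u y 1) x - pd 1 (fun y => u y 0) x]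

/-- The divergence of a vector field on `ℝ³`. -/
noncomputable def div3 (u : (Fin 3 → ℝ) → (Fin 3 → ℝ)) (x : Fin 3 → ℝ) : ℝ :=
  ∑ j : Fin 3, pd j (fun y => u y j) x

theorem pd_add {f g : (Fin 3 → ℝ) → ℝ} {x : Fin 3 → ℝ} (j : Fin 3)
    (hf : DifferentiableAt ℝ f x) (hg : DifferentiableAt ℝ g x) :
    pd j (fun y => f y + g y) x = pd j f x + pd j g x := by
  simp [pd, fderiv_fun_add hf hg]

theorem pd_sub {f g : (Fin 3 → ℝ) → ℝ} {x : Fin 3 → ℝ} (j : Fin 3)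
    (hf : DifferentiableAt ℝ f x) (hg : DifferentiableAt ℝ g x) :
    pd j (fun y => f y - g y) x = pd j f x - pd j g x := by
  simp [pd, fderiv_fun_sub hf hg]

theorem pd_const_mul {f : (Fin 3 → ℝ) → ℝ} {x : Fin 3 → ℝ} (j : Fin 3) (c : ℝ)
    (hf : DifferentiableAt ℝ f x) :
    pd j (fun y => c * f y) x = c * pd j f x := by
  simp [pd, fderiv_const_mul hf]

theorem pd_const (j : Fin 3) (c : ℝ) (x : Fin 3 → ℝ) : pd j (fun _ => c) x = 0 := by
  simp [pd]

theorem ContDiff.differentiable_pd {f : (Fin 3 → ℝ) → ℝ} (hf : ContDiff ℝ 2 f) (j : Fin 3) :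
    Differentiable ℝ (pd j f) := by
  have h : Differentiable ℝ (fderiv ℝ f) :=
    (hf.fderiv_right (m := 1) (by norm_num)).differentiable (by norm_num)
  exact fun x => (h x).clm_apply (differentiableAt_const _)

/-- Partial derivatives of a `C²` function commute. -/
theorem ContDiff.pd_comm {f : (Fin 3 → ℝ) → ℝ} (hf : ContDiff ℝ 2 f) (j k : Fin 3)
    (x : Fin 3 → ℝ) : pd j (pd k f) x = pd k (pd j f) x := by
  have h : Differentiable ℝ (fderiv ℝ f) :=
    (hf.fderiv_right (m := 1) (by norm_num)).differentiable (by norm_num)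
  have key (j k : Fin 3) : pd j (pd k f) x =
      fderiv ℝ (fderiv ℝ f) x (Pi.single j 1) (Pi.single k 1) := by
    change fderiv ℝ (fun y => fderiv ℝ f y (Pi.single k 1)) x (Pi.single j 1) = _
    rw [fderiv_clm_apply (h x) (differentiableAt_const _)]
    simp
  rw [key, key]
  exact (hf.contDiffAt.isSymmSndFDerivAt (by simp)).eq _ _

theorem curl_eq_smul_iff {u : (Fin 3 → ℝ) → (Fin 3 → ℝ)} {μ : ℝ} {x : Fin 3 → ℝ} :
    curl u x = μ • u x ↔
      pd 1 (fun y => u y 2) x - pd 2 (fun y => u y 1) x = μ * u x 0 ∧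
      pd 2 (fun y => u y 0) x - pd 0 (fun y => u y 2) x = μ * u x 1 ∧
      pd 0 (fun y => u y 1) x - pd 1 (fun y => u y 0) x = μ * u x 2 := by
  simp [funext_iff, Fin.forall_fin_succ, curl]

/-- A divergence-free `C²` Beltrami field is a Laplace eigenfield. -/
theorem laplacian_of_curl_eq_smul {u : (Fin 3 → ℝ) → (Fin 3 → ℝ)} {μ : ℝ}
    (hu : ContDiff ℝ 2 u) (hdiv : ∀ x, div3 u x = 0) (hcurl : ∀ x, curl u x = μ • u x)
    (x : Fin 3 → ℝ) (i : Fin 3) :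
    ∑ j : Fin 3, pd j (fun y => pd j (fun z => u z i) y) x = -(μ ^ 2 * u x i) := by
  have hc (k : Fin 3) : ContDiff ℝ 2 (fun y => u y k) := contDiff_pi.1 hu k
  have hd (k : Fin 3) : DifferentiableAt ℝ (fun y => u y k) x :=
    (hc k).differentiable (by norm_num) x
  have hp (j k : Fin 3) : DifferentiableAt ℝ (pd j (fun y => u y k)) x :=
    (hc k).differentiable_pd j x
  have hE (y : Fin 3 → ℝ) := curl_eq_smul_iff.1 (hcurl y)
  have curl_pd {a b k l m : Fin 3}
      (h : ∀ y, pd a (fun z => u z k) y - pd b (fun z => u z l) y = μ * u y m) (j : Fin 3) :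
      pd j (pd a (fun z => u z k)) x - pd j (pd b (fun z => u z l)) x
        = μ * pd j (fun z => u z m) x := by
    rw [← pd_sub j (hp a k) (hp b l), ← pd_const_mul j μ (hd m), funext h]
  have c0 := curl_pd fun y => (hE y).1
  have c1 := curl_pd fun y => (hE y).2.1
  have c2 := curl_pd fun y => (hE y).2.2
  have dv (j : Fin 3) : pd j (pd 0 (fun z => u z 0)) x + pd j (pd 1 (fun z => u z 1)) x
      + pd j (pd 2 (fun z => u z 2)) x = 0 := by
    rw [← pd_add j (hp 0 0) (hp 1 1), ← pd_add j ((hp 0 0).fun_add (hp 1 1)) (hp 2 2),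
      ← pd_const j 0 x]
    congr 1
    ext y
    simpa [div3, Fin.sum_univ_three] using hdiv y
  have cm (j k m : Fin 3) := (hc m).pd_comm j k x
  obtain ⟨e0, e1, e2⟩ := hE x
  rw [Fin.sum_univ_three]
  change pd 0 (pd 0 _) x + pd 1 (pd 1 _) x + pd 2 (pd 2 _) x = _
  fin_cases i
  · dsimp only [Fin.zero_eta]
    linear_combination dv 0 - c2 1 + c1 2 - μ * e0 + cm 1 0 1 + cm 2 0 2
  · dsimp only [Fin.mk_one]
    linear_combination dv 1 - c0 2 + c2 0 - μ * e1 + cm 2 1 2 + cm 0 1 0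
  · dsimp only [Fin.reduceFinMk]
    linear_combination dv 2 - c1 0 + c0 1 - μ * e2 + cm 0 2 0 + cm 1 2 1

theorem pd_bernoulli {u : (Fin 3 → ℝ) → (Fin 3 → ℝ)} {x : Fin 3 → ℝ}
    (hu : DifferentiableAt ℝ u x) (h : ℝ) (i : Fin 3) :
    pd i (fun y => h - (∑ j : Fin 3, u y j ^ 2) / 2) x
      = -∑ j : Fin 3, u x j * pd i (fun y => u y j) x := by
  have hd (j : Fin 3) := (differentiableAt_pi.1 hu j).hasFDerivAt
  have hs := ((HasFDerivAt.fun_sum (u := Finset.univ)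
    fun j _ => (hd j).pow 2).mul_const (2⁻¹ : ℝ)).const_sub h
  simp only [← div_eq_mul_inv] at hs
  rw [pd, hs.fderiv]
  simp [pd, Fin.sum_univ_three]
  ring

/-- For a Beltrami field the convective term is the gradient of the kinetic energy. -/
theorem convective_of_curl_eq_smul {u : (Fin 3 → ℝ) → (Fin 3 → ℝ)} {μ : ℝ} {x : Fin 3 → ℝ}
    (hu : DifferentiableAt ℝ u x) (hcurl : curl u x = μ • u x) (h : ℝ) (i : Fin 3) :
    ∑ j : Fin 3, u x j * pd j (fun y => u y i) x
      = -pd i (fun y => h - (∑ j : Fin 3, u y j ^ 2) / 2) x := by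
  obtain ⟨e0, e1, e2⟩ := curl_eq_smul_iff.1 hcurl
  rw [pd_bernoulli hu, neg_neg, Fin.sum_univ_three, Fin.sum_univ_three]
  fin_cases i
  · dsimp only [Fin.zero_eta]
    linear_combination u x 2 * e1 - u x 1 * e2
  · dsimp only [Fin.mk_one]
    linear_combination u x 0 * e2 - u x 2 * e0
  · dsimp only [Fin.reduceFinMk]
    linear_combination u x 1 * e0 - u x 0 * e1

/-- **NS-Beltrami generalized steady flows are exact Navier–Stokes solutions.**
If `u₀, u₁` are `C²` divergence-free Beltrami fields with the same eigenvalue `μ`,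
then `U(x,t) = u₀(x) + exp(−νμ²t)·u₁(x)`, with pressure `p = h − ‖U‖²/2` and
force `f = νμ²·u₀`, solves the incompressible Navier–Stokes equations. -/
theorem ns_beltrami_generalized_steady_flow
    (ν μ h : ℝ) (u₀ u₁ : (Fin 3 → ℝ) → (Fin 3 → ℝ))
    (h₀ : ContDiff ℝ 2 u₀) (h₁ : ContDiff ℝ 2 u₁)
    (hdiv₀ : ∀ x : Fin 3 → ℝ, div3 u₀ x = 0)
    (hdiv₁ : ∀ x : Fin 3 → ℝ, div3 u₁ x = 0)
    (hcurl₀ : ∀ x : Fin 3 → ℝ, curl u₀ x = μ • u₀ x)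
    (hcurl₁ : ∀ x : Fin 3 → ℝ, curl u₁ x = μ • u₁ x)
    (U : (Fin 3 → ℝ) → ℝ → (Fin 3 → ℝ))
    (hU : ∀ (x : Fin 3 → ℝ) (t : ℝ),
      U x t = u₀ x + Real.exp (-(ν * μ ^ 2 * t)) • u₁ x)
    (p : (Fin 3 → ℝ) → ℝ → ℝ)
    (hp : ∀ (x : Fin 3 → ℝ) (t : ℝ), p x t = h - (∑ i : Fin 3, U x t i ^ 2) / 2)
    (f : (Fin 3 → ℝ) → (Fin 3 → ℝ))
    (hf : ∀ x : Fin 3 → ℝ, f x = (ν * μ ^ 2) • u₀ x) :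
    (∀ (x : Fin 3 → ℝ) (t : ℝ) (i : Fin 3),
      deriv (fun s => U x s i) t
        + ∑ j : Fin 3, U x t j * pd j (fun y => U y t i) x
      = - pd i (fun y => p y t) x
        + ν * (∑ j : Fin 3, pd j (fun y => pd j (fun z => U z t i) y) x)
        + f x i)
    ∧ (∀ (x : Fin 3 → ℝ) (t : ℝ), div3 (fun y => U y t) x = 0) := by
  have hd₀ (k : Fin 3) : Differentiable ℝ (fun y => u₀ y k) :=
    (contDiff_pi.1 h₀ k).differentiable (by norm_num)
  have hd₁ (k : Fin 3) : Differentiable ℝ (fun y => u₁ y k) :=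
    (contDiff_pi.1 h₁ k).differentiable (by norm_num)
  have hUC (t : ℝ) : ContDiff ℝ 2 (fun y => U y t) := by
    simp only [hU]
    exact h₀.add (h₁.const_smul _)
  have hpd (t : ℝ) (x : Fin 3 → ℝ) (j k : Fin 3) : pd j (fun y => U y t k) x =
      pd j (fun y => u₀ y k) x
        + Real.exp (-(ν * μ ^ 2 * t)) * pd j (fun y => u₁ y k) x := by
    simp only [hU, Pi.add_apply, Pi.smul_apply, smul_eq_mul]
    rw [pd_add j (hd₀ k x) ((hd₁ k x).const_mul _), pd_const_mul j _ (hd₁ k x)]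
  have hUdiv (t : ℝ) (x : Fin 3 → ℝ) : div3 (fun y => U y t) x = 0 := by
    have e₀ := hdiv₀ x
    have e₁ := hdiv₁ x
    simp only [div3, hpd, Finset.sum_add_distrib, ← Finset.mul_sum] at e₀ e₁ ⊢
    rw [e₀, e₁, mul_zero, add_zero]
  have hUcurl (t : ℝ) (x : Fin 3 → ℝ) : curl (fun y => U y t) x = μ • U x t := by
    obtain ⟨a0, a1, a2⟩ := curl_eq_smul_iff.1 (hcurl₀ x)
    obtain ⟨b0, b1, b2⟩ := curl_eq_smul_iff.1 (hcurl₁ x)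
    rw [curl_eq_smul_iff (u := fun y => U y t)]
    simp only [hpd]
    simp only [hU, Pi.add_apply, Pi.smul_apply, smul_eq_mul]
    refine ⟨?_, ?_, ?_⟩
    · linear_combination a0 + Real.exp (-(ν * μ ^ 2 * t)) * b0
    · linear_combination a1 + Real.exp (-(ν * μ ^ 2 * t)) * b1
    · linear_combination a2 + Real.exp (-(ν * μ ^ 2 * t)) * b2
  refine ⟨fun x t i => ?_, fun x t => hUdiv t x⟩
  have ht : deriv (fun s => U x s i) t =
      -(ν * μ ^ 2) * (Real.exp (-(ν * μ ^ 2 * t)) * u₁ x i) := by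
    have hlin : HasDerivAt (fun s : ℝ => -(ν * μ ^ 2 * s)) (-(ν * μ ^ 2)) t := by
      simpa using ((hasDerivAt_id t).const_mul (ν * μ ^ 2)).fun_neg
    simp only [hU, Pi.add_apply, Pi.smul_apply, smul_eq_mul]
    rw [((hlin.exp.mul_const (u₁ x i)).const_add (u₀ x i)).deriv]
    ring
  have hconv := convective_of_curl_eq_smul
    ((hUC t).differentiable (by norm_num) x) (hUcurl t x) h i
  rw [ht, hconv, laplacian_of_curl_eq_smul (hUC t) (hUdiv t) (hUcurl t) x i, hf]
  simp only [hp]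
  simp only [hU, Pi.add_apply, Pi.smul_apply, smul_eq_mul]
  ring
end

section
/- Let k, v, w ∈ ℝ³ with k ≠ 0, let μ ∈ ℝ, and define the Fourier mode Y(x) = cos(2π⟨k,x⟩)·v + sin(2π⟨k,x⟩)·w. Then Y satisfies the Beltrami equation curl Y(x) = μ·Y(x) for all x ∈ ℝ³ if and only if the two algebraic conditions μ·v = 2π·(k × w) and μ·w = −2π·(k × v) hold. -/
open Real

/-- The Euclidean inner product on `ℝ³ = Fin 3 → ℝ`. -/
def dot (a b : Fin 3 → ℝ) : ℝ := ∑ i : Fin 3, a i * b i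

theorem hasFDerivAt_dot (k x : Fin 3 → ℝ) :
    HasFDerivAt (dot k)
      (∑ i : Fin 3, k i • ContinuousLinearMap.proj (R := ℝ) (φ := fun _ => ℝ) i) x :=
  HasFDerivAt.fun_sum fun i _ => (hasFDerivAt_apply i x).const_mul (k i)

theorem dot_smul (k x : Fin 3 → ℝ) (c : ℝ) : dot k (c • x) = c * dot k x := by
  simp only [dot, Pi.smul_apply, smul_eq_mul, Finset.mul_sum]
  exact Finset.sum_congr rfl fun i _ => mul_left_comm _ _ _

theorem dot_self_ne_zero {k : Fin 3 → ℝ} (hk : k ≠ 0) : dot k k ≠ 0 := fun h =>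
  hk (dotProduct_self_eq_zero.mp h)

theorem pd_cos_mul_add_sin_mul (k x : Fin 3 → ℝ) (j : Fin 3) (a b : ℝ) :
    pd j (fun y => cos (2 * π * dot k y) * a + sin (2 * π * dot k y) * b) x
      = 2 * π * k j * (cos (2 * π * dot k x) * b - sin (2 * π * dot k x) * a) := by
  have h := (hasFDerivAt_dot k x).const_mul (2 * π)
  have hd := (h.cos.mul_const a).add (h.sin.mul_const b)
  have hj : (∑ i : Fin 3, k i • ContinuousLinearMap.proj (R := ℝ) (φ := fun _ => ℝ) i)
      (Pi.single j 1) = k j := by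
    simp [Pi.single_apply]
  have hf := congrArg (fun L => L (Pi.single j 1)) hd.fderiv
  simp only [add_apply, smul_apply, hj, smul_eq_mul] at hf
  refine hf.trans ?_
  ring

theorem curl_fourier_mode (k v w x : Fin 3 → ℝ) :
    curl (fun y => cos (2 * π * dot k y) • v + sin (2 * π * dot k y) • w) x
      = cos (2 * π * dot k x) • ((2 * π) • crossProduct k w)
        + sin (2 * π * dot k x) • -((2 * π) • crossProduct k v) := by
  simp only [curl, Pi.add_apply, Pi.smul_apply, smul_eq_mul, pd_cos_mul_add_sin_mul]
  ext i
  fin_cases i <;> simp [cross_apply] <;> ring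

/-- **Beltrami equation for a single Fourier mode.** For `k ≠ 0`, the mode
`Y(x) = cos(2π⟨k,x⟩)·v + sin(2π⟨k,x⟩)·w` satisfies `curl Y = μ·Y` everywhere
if and only if `μ·v = 2π·(k × w)` and `μ·w = −2π·(k × v)`. -/
theorem fourier_mode_beltrami_iff
    (k v w : Fin 3 → ℝ) (hk : k ≠ 0) (μ : ℝ)
    (Y : (Fin 3 → ℝ) → (Fin 3 → ℝ))
    (hY : ∀ x : Fin 3 → ℝ,
      Y x = Real.cos (2 * π * dot k x) • v + Real.sin (2 * π * dot k x) • w) :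
    (∀ x : Fin 3 → ℝ, curl Y x = μ • Y x)
      ↔ (μ • v = (2 * π) • (crossProduct k w)
          ∧ μ • w = -((2 * π) • (crossProduct k v))) := by
  obtain rfl : Y = fun x => cos (2 * π * dot k x) • v + sin (2 * π * dot k x) • w :=
    funext hY
  simp only [curl_fourier_mode]
  constructor
  · intro h
    have hquarter : 2 * π * dot k ((4 * dot k k)⁻¹ • k) = π / 2 := by
      rw [dot_smul]
      field_simp [dot_self_ne_zero hk]
      norm_num
    have h₀ := h ((0 : ℝ) • k)
    have h₁ := h ((4 * dot k k)⁻¹ • k)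
    rw [dot_smul] at h₀
    rw [hquarter] at h₁
    simp only [zero_mul, mul_zero, cos_zero, sin_zero, one_smul, zero_smul, add_zero] at h₀
    simp only [cos_pi_div_two, sin_pi_div_two, one_smul, zero_smul, zero_add] at h₁
    exact ⟨h₀.symm, h₁.symm⟩
  · rintro ⟨hv, hw⟩ x
    rw [← hw, ← hv, smul_add, smul_comm μ, smul_comm μ]
end

section
/- (Stagnation points of the AAA flow.) Let A ∈ ℝ, A ≠ 0, and define V : ℝ³ → ℝ³ by V(x,y,z) = 2A·(cos(2πy) + cos(2πz), cos(2πx) − sin(2πz), sin(2πy) − sin(2πx)). Then for (x,y,z) ∈ [0,1) × [0,1) × [0,1), one has V(x,y,z) = (0,0,0) if and only if (x,y,z) is one of the eight points (1/8,1/8,3/8), (1/8,3/8,1/8), (3/8,1/8,5/8), (3/8,3/8,7/8), (5/8,5/8,7/8), (5/8,7/8,5/8), (7/8,5/8,1/8), (7/8,7/8,3/8). -/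
open Real

/-- The `(A,A,A)` Beltrami vector field of the paper. -/
noncomputable def VAAA (A : ℝ) (p : Fin 3 → ℝ) : Fin 3 → ℝ :=
  (2 * A) • ![Real.cos (2 * π * p 1) + Real.cos (2 * π * p 2),
              Real.cos (2 * π * p 0) - Real.sin (2 * π * p 2),
              Real.sin (2 * π * p 1) - Real.sin (2 * π * p 0)]

lemma cos_one_eighth_turn : cos (2 * π * (1 / 8)) = √2 / 2 := by
  rw [show 2 * π * (1 / 8) = π / 4 by ring, Real.cos_pi_div_four]

lemma cos_three_eighths_turn : cos (2 * π * (3 / 8)) = -(√2 / 2) := by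
  rw [show 2 * π * (3 / 8) = π - π / 4 by ring, Real.cos_pi_sub, Real.cos_pi_div_four]

lemma cos_five_eighths_turn : cos (2 * π * (5 / 8)) = -(√2 / 2) := by
  rw [show 2 * π * (5 / 8) = π / 4 + π by ring, Real.cos_add_pi, Real.cos_pi_div_four]

lemma cos_seven_eighths_turn : cos (2 * π * (7 / 8)) = √2 / 2 := by
  rw [show 2 * π * (7 / 8) = 2 * π - π / 4 by ring, Real.cos_two_pi_sub, Real.cos_pi_div_four]

lemma sin_one_eighth_turn : sin (2 * π * (1 / 8)) = √2 / 2 := by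
  rw [show 2 * π * (1 / 8) = π / 4 by ring, Real.sin_pi_div_four]

lemma sin_three_eighths_turn : sin (2 * π * (3 / 8)) = √2 / 2 := by
  rw [show 2 * π * (3 / 8) = π - π / 4 by ring, Real.sin_pi_sub, Real.sin_pi_div_four]

lemma sin_five_eighths_turn : sin (2 * π * (5 / 8)) = -(√2 / 2) := by
  rw [show 2 * π * (5 / 8) = π / 4 + π by ring, Real.sin_add_pi, Real.sin_pi_div_four]

lemma sin_seven_eighths_turn : sin (2 * π * (7 / 8)) = -(√2 / 2) := by
  rw [show 2 * π * (7 / 8) = 2 * π - π / 4 by ring, Real.sin_two_pi_sub, Real.sin_pi_div_four]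

lemma eq_odd_div_eight_of_cos_sq {u : ℝ} (hu : u ∈ Set.Ico (0 : ℝ) 1)
    (h : cos (2 * π * u) ^ 2 = 1 / 2) :
    u = 1 / 8 ∨ u = 3 / 8 ∨ u = 5 / 8 ∨ u = 7 / 8 := by
  have hc : cos (2 * (2 * π * u)) = 0 := by rw [Real.cos_two_mul, h]; norm_num
  obtain ⟨k, hk⟩ := Real.cos_eq_zero_iff.mp hc
  have huk : u = (2 * k + 1) / 8 := by
    have := Real.pi_ne_zero
    field_simp at hk
    linarith
  obtain ⟨hu0, hu1⟩ := hu
  have hk0 : -1 < k := by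
    have : (-1 : ℝ) < k := by linarith
    exact_mod_cast this
  have hk4 : k < 4 := by
    have : (k : ℝ) < 4 := by linarith
    exact_mod_cast this
  interval_cases k <;> norm_num at huk <;> simp [huk]

lemma VAAA_eq_zero_iff {A : ℝ} (hA : A ≠ 0) {p : Fin 3 → ℝ} :
    VAAA A p = 0 ↔
      cos (2 * π * p 1) + cos (2 * π * p 2) = 0 ∧
      cos (2 * π * p 0) = sin (2 * π * p 2) ∧
      sin (2 * π * p 1) = sin (2 * π * p 0) := by
  simp [VAAA, hA, sub_eq_zero]

/-- **Stagnation points of the AAA flow.** For `A ≠ 0`, within the fundamental cell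
`[0,1)³` the field `V_{(A,A,A)}` vanishes exactly at the eight listed points. -/
theorem aaa_stagnation_points (A : ℝ) (hA : A ≠ 0)
    (p : Fin 3 → ℝ)
    (h0 : p 0 ∈ Set.Ico (0 : ℝ) 1)
    (h1 : p 1 ∈ Set.Ico (0 : ℝ) 1)
    (h2 : p 2 ∈ Set.Ico (0 : ℝ) 1) :
    VAAA A p = 0
      ↔ (p = ![1/8, 1/8, 3/8] ∨ p = ![1/8, 3/8, 1/8]
          ∨ p = ![3/8, 1/8, 5/8] ∨ p = ![3/8, 3/8, 7/8]
          ∨ p = ![5/8, 5/8, 7/8] ∨ p = ![5/8, 7/8, 5/8]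
          ∨ p = ![7/8, 5/8, 1/8] ∨ p = ![7/8, 7/8, 3/8]) := by
  rw [VAAA_eq_zero_iff hA]
  constructor
  · rintro ⟨e0, e1, e2⟩
    have hx := Real.sin_sq_add_cos_sq (2 * π * p 0)
    have hy := Real.sin_sq_add_cos_sq (2 * π * p 1)
    have hz := Real.sin_sq_add_cos_sq (2 * π * p 2)
    have hcz : cos (2 * π * p 2) = -cos (2 * π * p 1) := by linarith
    rw [← e1, hcz] at hz
    rw [e2] at hy
    have hp : p = ![p 0, p 1, p 2] := by
      ext i; fin_cases i <;> rfl
    have hs : 0 < √2 := by positivity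
    rcases eq_odd_div_eight_of_cos_sq h0 (by linarith) with a | a | a | a <;>
    rcases eq_odd_div_eight_of_cos_sq h1 (by linarith) with b | b | b | b <;>
    rcases eq_odd_div_eight_of_cos_sq h2 (by rw [hcz]; linarith) with c | c | c | c <;>
    rw [a, b, c] at hp <;>
    simp only [a, b, c, cos_one_eighth_turn, cos_three_eighths_turn, cos_five_eighths_turn,
      cos_seven_eighths_turn, sin_one_eighth_turn, sin_three_eighths_turn,
      sin_five_eighths_turn, sin_seven_eighths_turn] at e0 e1 e2 <;>
    first
      | (exfalso; linarith)
      | simp only [hp, true_or, or_true]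
  · rintro (rfl | rfl | rfl | rfl | rfl | rfl | rfl | rfl) <;>
    simp [-one_div, cos_one_eighth_turn, cos_three_eighths_turn, cos_five_eighths_turn,
      cos_seven_eighths_turn, sin_one_eighth_turn, sin_three_eighths_turn,
      sin_five_eighths_turn, sin_seven_eighths_turn]
end

section
/- (b-deformation of the ABC flow is possible if and only if C = 0.) Let A, B, C ∈ ℝ and define, for x ≠ 0, the functions α₁(x,y,z) = (2A·cos(2πy) + 2B·cos(2πz))/x, α₂(x,y,z) = 2C·cos(2πx) − 2B·sin(2πz), α₃(x,y,z) = 2A·sin(2πy) − 2C·sin(2πx). Then the b-Beltrami equations with eigenvalue 2π, which in components read (i) ∂ᵧα₃ − ∂_zα₂ = 2π·x·α₁, (ii) ∂ₓα₃ − ∂_zα₁ = −2π·α₂/x, (iii) ∂ₓα₂ − ∂ᵧα₁ = 2π·α₃/x, hold at every point (x,y,z) with x ≠ 0 if and only if C = 0. Moreover, identity (i) holds for all A, B, C, while the left-hand sides of (ii) and (iii) differ from their right-hand sides exactly by −4πC·cos(2πx)·(x−1)/x and −4πC·sin(2πx)·(x−1)/x respectively. -/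
open Real

/-- First component of the `𝔟`-deformed ABC one-form: `α₁ = (2A cos(2πy) + 2B cos(2πz))/x`. -/
noncomputable def bAlpha₁ (A B : ℝ) (p : Fin 3 → ℝ) : ℝ :=
  (2 * A * Real.cos (2 * π * p 1) + 2 * B * Real.cos (2 * π * p 2)) / p 0

/-- Second component of the `𝔟`-deformed ABC one-form: `α₂ = 2C cos(2πx) − 2B sin(2πz)`. -/
noncomputable def bAlpha₂ (B C : ℝ) (p : Fin 3 → ℝ) : ℝ :=
  2 * C * Real.cos (2 * π * p 0) - 2 * B * Real.sin (2 * π * p 2)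

/-- Third component of the `𝔟`-deformed ABC one-form: `α₃ = 2A sin(2πy) − 2C sin(2πx)`. -/
noncomputable def bAlpha₃ (A C : ℝ) (p : Fin 3 → ℝ) : ℝ :=
  2 * A * Real.sin (2 * π * p 1) - 2 * C * Real.sin (2 * π * p 0)

theorem pd_eq_of_hasFDerivAt {f : (Fin 3 → ℝ) → ℝ} {f' : (Fin 3 → ℝ) →L[ℝ] ℝ}
    {p : Fin 3 → ℝ} (h : HasFDerivAt f f' p) (j : Fin 3) : pd j f p = f' (Pi.single j 1) := by
  rw [pd, h.fderiv]

theorem hasFDerivAt_two_pi_mul_apply (i : Fin 3) (p : Fin 3 → ℝ) :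
    HasFDerivAt (fun q : Fin 3 → ℝ => 2 * π * q i)
      ((2 * π) • ContinuousLinearMap.proj (R := ℝ) (φ := fun _ : Fin 3 => ℝ) i) p :=
  (hasFDerivAt_apply i p).const_mul (2 * π)

theorem pd_bAlpha₁ (A B : ℝ) {p : Fin 3 → ℝ} (hp : p 0 ≠ 0) :
    pd 1 (bAlpha₁ A B) p = -(4 * π * A) * Real.sin (2 * π * p 1) / p 0
      ∧ pd 2 (bAlpha₁ A B) p = -(4 * π * B) * Real.sin (2 * π * p 2) / p 0 := by
  have h : HasFDerivAt (bAlpha₁ A B) _ p :=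
    (((hasFDerivAt_two_pi_mul_apply 1 p).cos.const_mul (2 * A)).add
      ((hasFDerivAt_two_pi_mul_apply 2 p).cos.const_mul (2 * B))).mul
      ((hasDerivAt_inv hp).comp_hasFDerivAt p (hasFDerivAt_apply 0 p))
  constructor <;> rw [pd_eq_of_hasFDerivAt h] <;> simp <;> ring

theorem pd_bAlpha₂ (B C : ℝ) (p : Fin 3 → ℝ) :
    pd 0 (bAlpha₂ B C) p = -(4 * π * C) * Real.sin (2 * π * p 0)
      ∧ pd 2 (bAlpha₂ B C) p = -(4 * π * B) * Real.cos (2 * π * p 2) := by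
  have h : HasFDerivAt (bAlpha₂ B C) _ p :=
    ((hasFDerivAt_two_pi_mul_apply 0 p).cos.const_mul (2 * C)).sub
      ((hasFDerivAt_two_pi_mul_apply 2 p).sin.const_mul (2 * B))
  constructor <;> rw [pd_eq_of_hasFDerivAt h] <;> simp <;> ring

theorem pd_bAlpha₃ (A C : ℝ) (p : Fin 3 → ℝ) :
    pd 0 (bAlpha₃ A C) p = -(4 * π * C) * Real.cos (2 * π * p 0)
      ∧ pd 1 (bAlpha₃ A C) p = 4 * π * A * Real.cos (2 * π * p 1) := by
  have h : HasFDerivAt (bAlpha₃ A C) _ p :=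
    ((hasFDerivAt_two_pi_mul_apply 1 p).sin.const_mul (2 * A)).sub
      ((hasFDerivAt_two_pi_mul_apply 0 p).sin.const_mul (2 * C))
  constructor <;> rw [pd_eq_of_hasFDerivAt h] <;> simp <;> ring

/-- **`𝔟`-deformation of the ABC flow is possible iff `C = 0`.** The componentwise
`𝔟`-Beltrami equations (i)–(iii) with eigenvalue `2π` hold at every point with `x ≠ 0`
iff `C = 0`; (i) always holds, and the defects of (ii), (iii) are
`−4πC cos(2πx)(x−1)/x` and `−4πC sin(2πx)(x−1)/x` respectively. -/
theorem bDeformed_abc_beltrami_iff_C_eq_zero (A B C : ℝ) :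
    ((∀ p : Fin 3 → ℝ, p 0 ≠ 0 →
        (pd 1 (bAlpha₃ A C) p - pd 2 (bAlpha₂ B C) p = 2 * π * p 0 * bAlpha₁ A B p
          ∧ pd 0 (bAlpha₃ A C) p - pd 2 (bAlpha₁ A B) p = -(2 * π * bAlpha₂ B C p) / p 0
          ∧ pd 0 (bAlpha₂ B C) p - pd 1 (bAlpha₁ A B) p = 2 * π * bAlpha₃ A C p / p 0))
      ↔ C = 0)
    ∧ (∀ p : Fin 3 → ℝ, p 0 ≠ 0 →
        pd 1 (bAlpha₃ A C) p - pd 2 (bAlpha₂ B C) p = 2 * π * p 0 * bAlpha₁ A B p)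
    ∧ (∀ p : Fin 3 → ℝ, p 0 ≠ 0 →
        (pd 0 (bAlpha₃ A C) p - pd 2 (bAlpha₁ A B) p) - (-(2 * π * bAlpha₂ B C p) / p 0)
          = -(4 * π * C) * Real.cos (2 * π * p 0) * (p 0 - 1) / p 0)
    ∧ (∀ p : Fin 3 → ℝ, p 0 ≠ 0 →
        (pd 0 (bAlpha₂ B C) p - pd 1 (bAlpha₁ A B) p) - 2 * π * bAlpha₃ A C p / p 0
          = -(4 * π * C) * Real.sin (2 * π * p 0) * (p 0 - 1) / p 0) := by
  have h₁ : ∀ p : Fin 3 → ℝ, p 0 ≠ 0 →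
      pd 1 (bAlpha₃ A C) p - pd 2 (bAlpha₂ B C) p = 2 * π * p 0 * bAlpha₁ A B p := by
    intro p hp
    rw [(pd_bAlpha₃ A C p).2, (pd_bAlpha₂ B C p).2, bAlpha₁]
    field_simp
    ring
  have h₂ : ∀ p : Fin 3 → ℝ, p 0 ≠ 0 →
      (pd 0 (bAlpha₃ A C) p - pd 2 (bAlpha₁ A B) p) - (-(2 * π * bAlpha₂ B C p) / p 0)
        = -(4 * π * C) * Real.cos (2 * π * p 0) * (p 0 - 1) / p 0 := by
    intro p hp
    rw [(pd_bAlpha₃ A C p).1, (pd_bAlpha₁ A B hp).2, bAlpha₂]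
    field_simp
    ring
  have h₃ : ∀ p : Fin 3 → ℝ, p 0 ≠ 0 →
      (pd 0 (bAlpha₂ B C) p - pd 1 (bAlpha₁ A B) p) - 2 * π * bAlpha₃ A C p / p 0
        = -(4 * π * C) * Real.sin (2 * π * p 0) * (p 0 - 1) / p 0 := by
    intro p hp
    rw [(pd_bAlpha₂ B C p).1, (pd_bAlpha₁ A B hp).1, bAlpha₃]
    field_simp
    ring
  refine ⟨⟨fun h => ?_, fun hC p hp => ⟨h₁ p hp, ?_, ?_⟩⟩, h₁, h₂, h₃⟩
  · have hp : (fun _ : Fin 3 => (2 : ℝ)) 0 ≠ 0 := two_ne_zero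
    have hd := h₂ (fun _ => 2) hp
    have hcos : Real.cos (2 * π * 2) = 1 := by
      simpa [mul_comm] using Real.cos_nat_mul_two_pi 2
    rw [sub_eq_zero.mpr (h (fun _ => 2) hp).2.1, hcos] at hd
    have hmul : π * C = 0 := by linarith
    exact (mul_eq_zero.mp hmul).resolve_left Real.pi_ne_zero
  · exact sub_eq_zero.mp ((h₂ p hp).trans (by simp [hC]))
  · exact sub_eq_zero.mp ((h₃ p hp).trans (by simp [hC]))
end
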